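/- Let N ≥ 2, γ > 1, K > 0 and β = 0. If (ρ, u) is a global classical solution with compact support of the N-dimensional Euler-Poisson equations with repulsive forces, with positive total mass M = ∫ρ dx and supports contained in a fixed bounded set Ω of positive finite volume |Ω|, then liminf_{t→∞} R(t)/t ≥ [N K M^{γ−1} / |Ω|^{γ−1}]^{1/2}, where R(t) = max{|x| : x ∈ supp ρ(t,·)}. -/

import Mathlib

open MeasureTheory Filter Real

section helpers
variable {N : ℕ}

lemma ibp_aux (w g : EuclideanSpace ℝ (Fin N) → ℝ) (hw : ContDiff ℝ 1 w) (hg : ContDiff ℝ 1 g)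
    (hc : HasCompactSupport g) (v : EuclideanSpace ℝ (Fin N)) :
    ∫ x, w x * fderiv ℝ g x v = - ∫ x, fderiv ℝ w x v * g x := by
  have hw' := hw.continuous_fderiv one_ne_zero
  have hg' := hg.continuous_fderiv one_ne_zero
  have hw0 := hw.continuous
  have hg0 := hg.continuous
  apply integral_mul_fderiv_eq_neg_fderiv_mul_of_integrable
  · exact Continuous.integrable_of_hasCompactSupport (by fun_prop) hc.mul_left
  · exact Continuous.integrable_of_hasCompactSupport (by fun_prop)
      (HasCompactSupport.mul_left (hc.fderiv_apply ℝ v))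
  · exact Continuous.integrable_of_hasCompactSupport (by fun_prop) hc.mul_left
  · exact fun x _ => (hw.differentiable one_ne_zero) x
  · exact fun x _ => (hg.differentiable one_ne_zero) x

lemma prod_integrable_aux (a b q : EuclideanSpace ℝ (Fin N) → ℝ) (ha : Continuous a)
    (hb : Continuous b) (hac : HasCompactSupport a) (hbc : HasCompactSupport b)
    (hq : LocallyIntegrable q) :
    Integrable (fun p : EuclideanSpace ℝ (Fin N) × EuclideanSpace ℝ (Fin N) =>
      a p.1 * (b p.2 * q (p.1 - p.2))) := by
  obtain ⟨R1, h1⟩ := hac.isCompact.isBounded.subset_closedBall 0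
  obtain ⟨R2, h2⟩ := hbc.isCompact.isBounded.subset_closedBall 0
  have hq' : Integrable ((Metric.closedBall (0:EuclideanSpace ℝ (Fin N)) (R1 + R2)).indicator q) :=
    (integrable_indicator_iff Metric.isClosed_closedBall.measurableSet).2
      (hq.integrableOn_isCompact (isCompact_closedBall _ _))
  have hb' : Integrable b := hb.integrable_of_hasCompactSupport hbc
  have h3 := Integrable.convolution_integrand (ContinuousLinearMap.mul ℝ ℝ) hb' hq'
  obtain ⟨C, hC⟩ := hac.exists_bound_of_continuous ha
  have h4 := h3.bdd_mul (c := C) (f := fun p : EuclideanSpace ℝ (Fin N) × EuclideanSpace ℝ (Fin N) => a p.1)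
    (by fun_prop) (Eventually.of_forall fun p => hC p.1)
  refine h4.congr (Eventually.of_forall fun p => ?_)
  simp only [ContinuousLinearMap.mul_apply']
  by_cases hx : a p.1 = 0
  · simp [hx]
  by_cases hy : b p.2 = 0
  · simp [hy]
  have hx' := h1 (subset_tsupport _ hx)
  have hy' := h2 (subset_tsupport _ hy)
  have : p.1 - p.2 ∈ Metric.closedBall (0:EuclideanSpace ℝ (Fin N)) (R1 + R2) := by
    simp only [Metric.mem_closedBall, dist_zero_right] at *
    exact (norm_sub_le _ _).trans (by linarith)
  simp [Set.indicator_of_mem this]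

lemma rep_eps (ρ k h : EuclideanSpace ℝ (Fin N) → ℝ) (hρ : ContDiff ℝ 1 ρ)
    (hc : HasCompactSupport ρ) (hρ0 : ∀ x, 0 ≤ ρ x)
    (hk : ∀ z, HasFDerivAt k (h z • innerSL ℝ z) z) (hh : Continuous h) (h0 : ∀ z, 0 ≤ h z)
    (heven : ∀ z, h (-z) = h z) :
    0 ≤ ∫ x, ∫ y, ρ x * (k (x - y) * fderiv ℝ ρ y x) := by
  have hk1 : ContDiff ℝ 1 k := by
    rw [contDiff_one_iff_fderiv]
    refine ⟨fun z => (hk z).differentiableAt, ?_⟩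
    have : fderiv ℝ k = fun z => h z • innerSL ℝ z := funext fun z => (hk z).fderiv
    rw [this]
    exact hh.smul (innerSL ℝ).continuous
  have hρc := hρ.continuous
  set F : EuclideanSpace ℝ (Fin N) × EuclideanSpace ℝ (Fin N) → ℝ :=
    fun p => ρ p.1 * (ρ p.2 * (h (p.1 - p.2) * inner ℝ (p.1 - p.2) p.1)) with hF
  have key : ∀ x, ∫ y, ρ x * (k (x - y) * fderiv ℝ ρ y x) = ∫ y, F (x, y) := by
    intro x
    rw [integral_const_mul, ibp_aux (fun y => k (x - y)) ρ (by fun_prop) hρ hc x]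
    simp only [hF]
    rw [integral_const_mul, ← integral_neg]
    congr 2
    ext y
    have : HasFDerivAt (fun y => k (x - y)) ((h (x - y) • innerSL ℝ (x - y)).comp
        (-(ContinuousLinearMap.id ℝ _))) y :=
      (hk (x - y)).comp y ((hasFDerivAt_id y).const_sub x)
    rw [this.fderiv]
    simp
    rw [inner_sub_left, real_inner_self_eq_norm_sq]
    ring
  have hFc : Continuous F := by fun_prop
  have hFcs : HasCompactSupport F := by
    refine HasCompactSupport.intro (hc.isCompact.prod hc.isCompact) ?_
    rintro ⟨x, y⟩ hxy
    simp only [Set.mem_prod, not_and_or] at hxy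
    rcases hxy with hx | hx
    · simp [hF, image_eq_zero_of_notMem_tsupport hx]
    · simp [hF, image_eq_zero_of_notMem_tsupport hx]
  have hFi : Integrable F (volume.prod volume) := hFc.integrable_of_hasCompactSupport hFcs
  simp_rw [key]
  rw [← integral_prod F hFi]
  have hsw := integral_prod_swap (μ := (volume : Measure (EuclideanSpace ℝ (Fin N))))
    (ν := (volume : Measure (EuclideanSpace ℝ (Fin N)))) F
  have hsum : 0 ≤ ∫ z, (F z + F z.swap) ∂(volume.prod volume) := by
    apply integral_nonneg
    rintro ⟨x, y⟩
    simp only [hF, Prod.swap, Pi.zero_apply]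
    have e1 : h (y - x) = h (x - y) := by rw [← heven, neg_sub]
    have e2 : inner ℝ (y - x) y = - inner ℝ (x - y) y := by rw [← inner_neg_left, neg_sub]
    rw [e1, e2]
    have e3 : inner ℝ (x - y) x - inner ℝ (x - y) y = ‖x - y‖ ^ 2 := by
      rw [← inner_sub_right, real_inner_self_eq_norm_sq]
    have : ρ x * (ρ y * (h (x - y) * inner ℝ (x - y) x)) +
      ρ y * (ρ x * (h (x - y) * -inner ℝ (x - y) y)) = ρ x * ρ y * h (x - y) * ‖x - y‖ ^ 2 := by
      rw [← e3]; ring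
    rw [this]
    have := hρ0 x
    have := hρ0 y
    have := h0 (x - y)
    positivity
  rw [integral_add hFi (show Integrable (fun z => F z.swap) (volume.prod volume) from hFi.swap), hsw] at hsum
  linarith

lemma rep_main (hN : 2 ≤ N) (ρ : EuclideanSpace ℝ (Fin N) → ℝ) (g : ℝ → ℝ) (hρ : ContDiff ℝ 1 ρ)
    (hc : HasCompactSupport ρ) (hρ0 : ∀ x, 0 ≤ ρ x)
    (hg : ContDiffOn ℝ 1 g (Set.Ioi 0)) (hmono : MonotoneOn g (Set.Ioi 0))
    (hloc : LocallyIntegrable (fun z : EuclideanSpace ℝ (Fin N) => g (‖z‖ ^ 2))) :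
    0 ≤ ∫ x, ρ x * ∫ y, (g (‖x - y‖ ^ 2) * fderiv ℝ ρ y x) := by
  have hρc := hρ.continuous
  have hρ' := hρ.continuous_fderiv one_ne_zero
  have hgd : ∀ s, 0 < s → HasDerivAt g (deriv g s) s := fun s hs =>
    ((hg.differentiableOn one_ne_zero).differentiableAt (Ioi_mem_nhds hs)).hasDerivAt
  have hgc' : ContinuousOn (deriv g) (Set.Ioi 0) := hg.continuousOn_deriv_of_isOpen isOpen_Ioi le_rfl
  have hgc := hg.continuousOn
  set V : ℝ → EuclideanSpace ℝ (Fin N) × EuclideanSpace ℝ (Fin N) → ℝ :=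
    fun ε p => ρ p.1 * (g (‖p.1 - p.2‖ ^ 2 + ε) * fderiv ℝ ρ p.2 p.1) with hV
  have hcont : ∀ ε, 0 < ε → Continuous (fun z : EuclideanSpace ℝ (Fin N) => g (‖z‖ ^ 2 + ε)) := by
    intro ε hε
    refine hgc.comp_continuous (by fun_prop) fun z => ?_
    show 0 < ‖z‖ ^ 2 + ε
    positivity
  -- bound
  set B : EuclideanSpace ℝ (Fin N) × EuclideanSpace ℝ (Fin N) → ℝ :=
    fun p => (ρ p.1 * ‖p.1‖) * (‖fderiv ℝ ρ p.2‖ * (|g (‖p.1 - p.2‖ ^ 2)| + |g (‖p.1 - p.2‖ ^ 2 + 1)|))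
    with hB
  have hBi : Integrable B (volume.prod volume) := by
    refine prod_integrable_aux (fun x => ρ x * ‖x‖) (fun y => ‖fderiv ℝ ρ y‖)
      (fun z => |g (‖z‖ ^ 2)| + |g (‖z‖ ^ 2 + 1)|) (by fun_prop) (by fun_prop) hc.mul_right
      (hc.fderiv ℝ).norm ?_
    exact LocallyIntegrable.add (fun x => (hloc x).norm) (hcont 1 one_pos).abs.locallyIntegrable
  have hne : ∀ᵐ p : EuclideanSpace ℝ (Fin N) × EuclideanSpace ℝ (Fin N) ∂(volume.prod volume),
      p.1 ≠ p.2 := by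
    have hms : MeasurableSet {p : EuclideanSpace ℝ (Fin N) × EuclideanSpace ℝ (Fin N) | p.1 = p.2} :=
      measurableSet_eq_fun measurable_fst measurable_snd
    rw [ae_iff]
    simp only [ne_eq, not_not]
    rw [Measure.measure_prod_null hms]
    refine Eventually.of_forall fun x => ?_
    have : Nontrivial (EuclideanSpace ℝ (Fin N)) := by
      have : Nonempty (Fin N) := ⟨⟨0, by omega⟩⟩
      infer_instance
    have : (Prod.mk x ⁻¹' {p : EuclideanSpace ℝ (Fin N) × EuclideanSpace ℝ (Fin N) | p.1 = p.2})
        = {x} := by ext y; simp [eq_comm]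
    simp [this]
  have hVB : ∀ ε, 0 ≤ ε → ε ≤ 1 → ∀ᵐ p ∂(volume.prod volume), ‖V ε p‖ ≤ B p := by
    intro ε h0 h1
    filter_upwards [hne] with p hp
    have hs : 0 < ‖p.1 - p.2‖ ^ 2 := by
      have : 0 < ‖p.1 - p.2‖ := norm_pos_iff.2 (sub_ne_zero.2 hp)
      positivity
    set s := ‖p.1 - p.2‖ ^ 2
    have m1 : g s ≤ g (s + ε) := hmono hs (show 0 < s + ε by positivity) (by linarith)
    have m2 : g (s + ε) ≤ g (s + 1) := hmono (show 0 < s + ε by positivity)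
      (show 0 < s + 1 by positivity) (by linarith)
    have m3 : |g (s + ε)| ≤ |g s| + |g (s + 1)| := by
      rw [abs_le]
      have := neg_abs_le (g s)
      have := le_abs_self (g (s+1))
      have := abs_nonneg (g (s+1))
      have := abs_nonneg (g s)
      constructor <;> linarith
    have m4 := (fderiv ℝ ρ p.2).le_opNorm p.1
    simp only [hV, hB, norm_mul]
    rw [Real.norm_of_nonneg (hρ0 p.1), Real.norm_eq_abs (g _)]
    calc ρ p.1 * (|g (s + ε)| * ‖fderiv ℝ ρ p.2 p.1‖)
        ≤ ρ p.1 * ((|g s| + |g (s + 1)|) * (‖fderiv ℝ ρ p.2‖ * ‖p.1‖)) := by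
          have := hρ0 p.1
          gcongr
      _ = _ := by ring
  have hVm : ∀ ε, 0 < ε → Continuous (V ε) := by
    intro ε hε
    have := (hcont ε hε).comp (continuous_fst.sub continuous_snd :
      Continuous fun p : EuclideanSpace ℝ (Fin N) × EuclideanSpace ℝ (Fin N) => p.1 - p.2)
    have h5 : Continuous fun p : EuclideanSpace ℝ (Fin N) × EuclideanSpace ℝ (Fin N) =>
      fderiv ℝ ρ p.2 p.1 := (hρ'.comp continuous_snd).clm_apply continuous_fst
    exact (hρc.comp continuous_fst).mul (this.mul h5)
  have hlim : ∀ᵐ p ∂(volume.prod volume),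
      Tendsto (fun n : ℕ => V (1 / ((n:ℝ) + 1)) p) atTop (nhds (V 0 p)) := by
    filter_upwards [hne] with p hp
    have hs : 0 < ‖p.1 - p.2‖ ^ 2 + 0 := by
      have : 0 < ‖p.1 - p.2‖ := norm_pos_iff.2 (sub_ne_zero.2 hp)
      positivity
    have hca := (hgd _ hs).continuousAt
    have ht : Tendsto (fun n : ℕ => ‖p.1 - p.2‖ ^ 2 + 1 / ((n:ℝ) + 1)) atTop
      (nhds (‖p.1 - p.2‖ ^ 2 + 0)) := tendsto_const_nhds.add tendsto_one_div_add_atTop_nhds_zero_nat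
    exact ((hca.tendsto.comp ht).mul_const _).const_mul _
  have hlimI : Tendsto (fun n : ℕ => ∫ p, V (1 / ((n:ℝ) + 1)) p ∂(volume.prod volume)) atTop
      (nhds (∫ p, V 0 p ∂(volume.prod volume))) := by
    refine tendsto_integral_of_dominated_convergence B (fun n => ?_) hBi (fun n => ?_) hlim
    · exact (hVm _ (by positivity)).aestronglyMeasurable
    · refine hVB _ (by positivity) ?_
      rw [div_le_one (by positivity)]
      have : (0:ℝ) ≤ n := by positivity
      linarith
  have hV0m : AEStronglyMeasurable (V 0) (volume.prod volume) :=
    aestronglyMeasurable_of_tendsto_ae atTop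
      (fun n : ℕ => (hVm (1 / ((n:ℝ) + 1)) (by positivity)).aestronglyMeasurable) hlim
  have hV0i : Integrable (V 0) (volume.prod volume) := hBi.mono' hV0m (hVB 0 le_rfl zero_le_one)
  have hpos : ∀ n : ℕ, 0 ≤ ∫ p, V (1 / ((n:ℝ) + 1)) p ∂(volume.prod volume) := by
    intro n
    have hε : (0:ℝ) < 1 / ((n:ℝ) + 1) := by positivity
    have hε1 : 1 / ((n:ℝ) + 1) ≤ 1 := by
      rw [div_le_one (by positivity)]
      have : (0:ℝ) ≤ n := by positivity
      linarith
    set ε := 1 / ((n:ℝ) + 1)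
    have hi : Integrable (V ε) (volume.prod volume) :=
      hBi.mono' (hVm ε hε).aestronglyMeasurable (hVB ε hε.le hε1)
    rw [integral_prod _ hi]
    refine rep_eps ρ (fun z => g (‖z‖ ^ 2 + ε)) (fun z => 2 * deriv g (‖z‖ ^ 2 + ε)) hρ hc hρ0
      ?_ ?_ ?_ ?_
    · intro z
      have hz : 0 < ‖z‖ ^ 2 + ε := by positivity
      have h1 : HasFDerivAt (fun z : EuclideanSpace ℝ (Fin N) => ‖z‖ ^ 2 + ε) (2 • innerSL ℝ z) z :=
        (hasStrictFDerivAt_norm_sq z).hasFDerivAt.add_const ε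
      have := (hgd _ hz).comp_hasFDerivAt z h1
      refine this.congr_fderiv ?_
      ext v
      simp
      ring
    · refine continuous_const.mul (hgc'.comp_continuous (by fun_prop) fun z => ?_)
      show 0 < ‖z‖ ^ 2 + ε
      positivity
    · intro z
      have hz : 0 < ‖z‖ ^ 2 + ε := by positivity
      have : 0 ≤ deriv g (‖z‖ ^ 2 + ε) := by
        rw [← derivWithin_of_isOpen isOpen_Ioi hz]
        exact hmono.derivWithin_nonneg
      positivity
    · intro z; simp
  have h0 := ge_of_tendsto' hlimI hpos
  rw [integral_prod _ hV0i] at h0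
  simp only [hV, add_zero] at h0
  simpa only [integral_const_mul] using h0

end helpers
section helpers2
variable {N : ℕ}

noncomputable def gker (N : ℕ) (s : ℝ) : ℝ :=
  if N = 2 then (1 / 2) * Real.log s else -s ^ (-((N:ℝ) - 2) / 2)

lemma gker_eq (z : EuclideanSpace ℝ (Fin N)) : gker N (‖z‖ ^ 2) =
    (if N = 2 then Real.log ‖z‖ else -‖z‖ ^ (-((N:ℝ) - 2))) := by
  unfold gker
  split_ifs
  · rw [Real.log_pow]; push_cast; ring
  · rw [← Real.rpow_natCast, ← Real.rpow_mul (norm_nonneg _)]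
    congr 2; push_cast; ring

lemma gker_contDiffOn : ContDiffOn ℝ 1 (gker N) (Set.Ioi 0) := by
  unfold gker
  intro x hx
  have hx' : x ≠ 0 := ne_of_gt hx
  split_ifs
  · exact (contDiffAt_const.mul (Real.contDiffAt_log.2 hx')).contDiffWithinAt
  · exact (Real.contDiffAt_rpow_const_of_ne hx').neg.contDiffWithinAt

lemma gker_mono (hN : 2 ≤ N) : MonotoneOn (gker N) (Set.Ioi 0) := by
  intro a ha b hb hab
  unfold gker
  split_ifs
  · have := Real.log_le_log ha hab
    linarith
  · have h2 : (2:ℝ) ≤ N := by exact_mod_cast hN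
    have := Real.rpow_le_rpow_of_nonpos ha hab (show -((N:ℝ) - 2) / 2 ≤ 0 by linarith)
    linarith

lemma gker_loc (hN : 2 ≤ N) :
    LocallyIntegrable (fun z : EuclideanSpace ℝ (Fin N) => gker N (‖z‖ ^ 2)) := by
  have hne : Nonempty (Fin N) := ⟨⟨0, by omega⟩⟩
  have hnt : Nontrivial (EuclideanSpace ℝ (Fin N)) := inferInstance
  have key : ∀ r : ℝ, IntegrableOn (fun z : EuclideanSpace ℝ (Fin N) => gker N (‖z‖ ^ 2))
      (Metric.ball 0 r) := by
    intro r
    simp_rw [gker_eq]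
    have := (integrableOn_fun_norm_addHaar (volume : Measure (EuclideanSpace ℝ (Fin N)))
      (f := fun y => (if N = 2 then Real.log y else -y ^ (-((N:ℝ) - 2)))) (r := r))
    rw [this]
    simp only [finrank_euclideanSpace, Fintype.card_fin, smul_eq_mul]
    by_cases h2 : N = 2
    · subst h2
      simp only [if_true]
      have : (fun y : ℝ => y ^ (2 - 1) * Real.log y) = fun y => y * Real.log y := by
        ext y; simp
      rw [this]
      exact (Real.continuous_mul_log.integrableOn_Icc (a := 0) (b := r)).mono_set Set.Ioo_subset_Icc_self
    · simp only [h2, if_false]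
      have : Set.EqOn (fun y : ℝ => -y) (fun y : ℝ => y ^ (N - 1) * -y ^ (-((N:ℝ) - 2)))
          (Set.Ioo 0 r) := by
        intro y hy
        have hy0 : 0 < y := hy.1
        simp only
        rw [mul_neg, ← Real.rpow_natCast, ← Real.rpow_add hy0, Nat.cast_sub (by omega)]
        have : ((N:ℝ) - (1:ℕ) + -((N:ℝ) - 2)) = 1 := by push_cast; ring
        rw [this, Real.rpow_one]
      refine IntegrableOn.congr_fun ?_ this measurableSet_Ioo
      exact (continuous_neg.integrableOn_Icc (a := 0) (b := r)).mono_set Set.Ioo_subset_Icc_self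
  intro x
  exact ⟨Metric.ball 0 (‖x‖ + 1), Metric.isOpen_ball.mem_nhds (by simp), key _⟩

lemma phi_aux (ρ : EuclideanSpace ℝ (Fin N) → ℝ) (k : EuclideanSpace ℝ (Fin N) → ℝ)
    (hk : LocallyIntegrable k) (hρ : ContDiff ℝ 1 ρ) (hc : HasCompactSupport ρ)
    (Φ : EuclideanSpace ℝ (Fin N) → ℝ) (hΦ : ∀ x, Φ x = ∫ y, k (x - y) * ρ y) :
    ContDiff ℝ 1 Φ ∧ ∀ x v, fderiv ℝ Φ x v = ∫ y, k (x - y) * fderiv ℝ ρ y v := by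
  have e : Φ = convolution k ρ (ContinuousLinearMap.mul ℝ ℝ) volume := by
    ext x
    rw [hΦ, convolution_eq_swap]
    simp
  refine ⟨e ▸ hc.contDiff_convolution_right _ hk hρ, fun x v => ?_⟩
  have h1 := hc.hasFDerivAt_convolution_right (ContinuousLinearMap.mul ℝ ℝ) hk hρ x
  rw [← e] at h1
  rw [h1.fderiv, convolution_precompR_apply _ hk (hc.fderiv ℝ) (hρ.continuous_fderiv one_ne_zero),
    convolution_eq_swap]
  simp

lemma repulsion_aux {N : ℕ} (hN : 2 ≤ N) (ρ : EuclideanSpace ℝ (Fin N) → ℝ) (hρ : ContDiff ℝ 1 ρ)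
    (hc : HasCompactSupport ρ) (hρ0 : ∀ x, 0 ≤ ρ x) (Φ : EuclideanSpace ℝ (Fin N) → ℝ)
    (hΦ : ∀ x, Φ x =
      ∫ y, (if N = 2 then Real.log ‖x - y‖ else -‖x - y‖ ^ (-((N:ℝ) - 2))) * ρ y) :
    ContDiff ℝ 1 Φ ∧ 0 ≤ ∫ x, ρ x * fderiv ℝ Φ x x := by
  simp_rw [← gker_eq] at hΦ
  obtain ⟨h1, h2⟩ := phi_aux ρ (fun z => gker N (‖z‖ ^ 2)) (gker_loc hN) hρ hc Φ hΦ
  refine ⟨h1, ?_⟩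
  simp_rw [h2]
  exact rep_main hN ρ (gker N) hρ hc hρ0 gker_contDiffOn (gker_mono hN) (gker_loc hN)
end helpers2
section helpers3
variable {N : ℕ}

lemma ode_aux (H J J' : ℝ → ℝ) (c C : ℝ) (hc : 0 < c)
    (hH : ∀ t, 0 < t → HasDerivAt H (2 * J t) t) (hJ : ∀ t, 0 < t → HasDerivAt J (J' t) t)
    (hJ' : ∀ t, 0 < t → c ≤ J' t) (hC : ∀ t, 0 < t → H t ≤ C) : False := by
  have m1 : MonotoneOn (fun t => J t - c * (t - 1)) (Set.Ici 1) := by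
    have hd : ∀ t, 0 < t → HasDerivAt (fun t => J t - c * (t - 1)) (J' t - c * 1) t := fun t ht =>
      (hJ t ht).sub (((hasDerivAt_id t).sub_const 1).const_mul c)
    refine monotoneOn_of_deriv_nonneg (convex_Ici 1) ?_ ?_ ?_
    · exact fun t ht => (hd t (lt_of_lt_of_le one_pos ht)).continuousAt.continuousWithinAt
    · rw [interior_Ici]
      exact fun t ht => (hd t (lt_trans one_pos ht)).differentiableAt.differentiableWithinAt
    · rw [interior_Ici]
      intro t ht
      have ht0 : 0 < t := lt_trans one_pos ht
      rw [(hd t ht0).deriv]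
      have := hJ' t ht0
      linarith
  have b1 : ∀ t, 1 ≤ t → J 1 + c * (t - 1) ≤ J t := by
    intro t ht
    have := m1 (Set.self_mem_Ici) ht ht
    simp only [sub_self, mul_zero, sub_zero] at this
    linarith
  have m2 : MonotoneOn (fun t => H t - (2 * J 1 * (t - 1) + c * (t - 1) ^ 2)) (Set.Ici 1) := by
    have hd : ∀ t, 0 < t → HasDerivAt (fun t => H t - (2 * J 1 * (t - 1) + c * (t - 1) ^ 2))
        (2 * J t - (2 * J 1 * 1 + c * ((2:ℕ) * (t - 1) ^ (2 - 1) * 1))) t := fun t ht =>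
      (hH t ht).sub ((((hasDerivAt_id t).sub_const 1).const_mul (2 * J 1)).add
        ((((hasDerivAt_id t).sub_const 1).pow 2).const_mul c))
    refine monotoneOn_of_deriv_nonneg (convex_Ici 1) ?_ ?_ ?_
    · exact fun t ht => (hd t (lt_of_lt_of_le one_pos ht)).continuousAt.continuousWithinAt
    · rw [interior_Ici]
      exact fun t ht => (hd t (lt_trans one_pos ht)).differentiableAt.differentiableWithinAt
    · rw [interior_Ici]
      intro t ht
      rw [(hd t (lt_trans one_pos ht)).deriv]
      have := b1 t (le_of_lt ht)
      norm_num
      linarith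
  have b2 : ∀ a, 0 ≤ a → H 1 + a * (c * a + 2 * J 1) ≤ C := by
    intro a ha
    have := m2 (Set.self_mem_Ici) (show (1:ℝ) ≤ 1 + a by linarith) (by linarith)
    have h3 := hC (1 + a) (by linarith)
    simp only [sub_self, mul_zero, add_sub_cancel_left] at this
    nlinarith
  have hp : 0 ≤ (|2 * J 1| + |C - H 1| + 1) / c := by positivity
  have b3 := b2 (1 + (|2 * J 1| + |C - H 1| + 1) / c) (by linarith)
  have e : c * (1 + (|2 * J 1| + |C - H 1| + 1) / c) = c + (|2 * J 1| + |C - H 1| + 1) := by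
    field_simp
  rw [e] at b3
  have i1 := neg_abs_le (2 * J 1)
  have i2 := le_abs_self (C - H 1)
  have i3 : |C - H 1| + 1 ≤ c + (|2 * J 1| + |C - H 1| + 1) + 2 * J 1 := by linarith
  have i4 := abs_nonneg (C - H 1)
  set q := (|2 * J 1| + |C - H 1| + 1) / c
  nlinarith [mul_nonneg hp (show 0 ≤ c + (|2 * J 1| + |C - H 1| + 1) + 2 * J 1 by linarith)]

lemma time_deriv_aux (f : ℝ → EuclideanSpace ℝ (Fin N) → ℝ)
    (hf : ContDiffOn ℝ 1 (fun p : ℝ × EuclideanSpace ℝ (Fin N) => f p.1 p.2)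
      (Set.Ioi (0:ℝ) ×ˢ Set.univ))
    (S : Set (EuclideanSpace ℝ (Fin N))) (hS : IsCompact S)
    (hz : ∀ t, 0 < t → ∀ x, x ∉ S → f t x = 0) (t : ℝ) (ht : 0 < t) :
    HasDerivAt (fun s => ∫ x, f s x) (∫ x, deriv (fun s => f s x) t) t := by
  set F := fun p : ℝ × EuclideanSpace ℝ (Fin N) => f p.1 p.2 with hF
  have hop : IsOpen (Set.Ioi (0:ℝ) ×ˢ (Set.univ : Set (EuclideanSpace ℝ (Fin N)))) :=
    isOpen_Ioi.prod isOpen_univ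
  have hc' : ContinuousOn (fun p => fderiv ℝ F p (1, 0)) (Set.Ioi (0:ℝ) ×ˢ Set.univ) :=
    (hf.continuousOn_fderiv_of_isOpen hop le_rfl).clm_apply continuousOn_const
  have hd : ∀ s, 0 < s → ∀ x, HasDerivAt (fun s => f s x) (fderiv ℝ F (s, x) (1, 0)) s := by
    intro s hs x
    have h1 : HasFDerivAt F (fderiv ℝ F (s, x)) (s, x) :=
      ((hf.differentiableOn one_ne_zero).differentiableAt
        (hop.mem_nhds (Set.mk_mem_prod (Set.mem_Ioi.2 hs) (Set.mem_univ x)))).hasFDerivAt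
    exact h1.comp_hasDerivAt s ((hasDerivAt_id s).prodMk (hasDerivAt_const s x))
  have hD : ∀ x, deriv (fun s => f s x) t = fderiv ℝ F (t, x) (1, 0) := fun x => (hd t ht x).deriv
  simp_rw [hD]
  have hcont : ∀ s, 0 < s → Continuous (f s) := by
    intro s hs
    exact hf.continuousOn.comp_continuous (f := fun x => (s, x)) (by fun_prop) fun x => ⟨hs, trivial⟩
  have hcs : ∀ s, 0 < s → HasCompactSupport (f s) := fun s hs => HasCompactSupport.intro hS (hz s hs)
  obtain ⟨C, hC⟩ := ((isCompact_Icc (a := t / 2) (b := 2 * t)).prod hS).exists_bound_of_continuousOn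
    (hc'.mono (fun p hp => ⟨lt_of_lt_of_le (by linarith) hp.1.1, trivial⟩))
  refine (hasDerivAt_integral_of_dominated_loc_of_deriv_le (F := f)
    (F' := fun s x => fderiv ℝ F (s, x) (1, 0)) (s := Set.Icc (t / 2) (2 * t))
    (bound := S.indicator fun _ => C)
    (Icc_mem_nhds (by linarith) (by linarith)) ?_ ?_ ?_ ?_ ?_ ?_).2
  · filter_upwards [Ioi_mem_nhds ht] with s hs
    exact (hcont s hs).aestronglyMeasurable
  · exact (hcont t ht).integrable_of_hasCompactSupport (hcs t ht)
  · refine Continuous.aestronglyMeasurable ?_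
    exact hc'.comp_continuous (f := fun x => (t, x)) (by fun_prop) fun x => ⟨ht, trivial⟩
  · refine Eventually.of_forall fun x s hs => ?_
    have hs0 : 0 < s := lt_of_lt_of_le (by linarith) hs.1
    by_cases hx : x ∈ S
    · rw [Set.indicator_of_mem hx]
      exact hC (s, x) ⟨hs, hx⟩
    · rw [Set.indicator_of_notMem hx]
      have : (fun s => f s x) =ᶠ[nhds s] fun _ => 0 := by
        filter_upwards [Ioi_mem_nhds hs0] with r hr
        exact hz r hr x hx
      rw [← (hd s hs0 x).deriv, this.deriv_eq]
      simp
  · exact (integrable_indicator_iff hS.measurableSet).2 (integrableOn_const hS.measure_lt_top.ne)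
  · refine Eventually.of_forall fun x s hs => hd s (lt_of_lt_of_le (by linarith) hs.1) x

lemma jensen_aux (ρ : EuclideanSpace ℝ (Fin N) → ℝ) (γ M : ℝ) (hγ : 1 < γ) (hM : 0 < M)
    (Ω : Set (EuclideanSpace ℝ (Fin N))) (hΩ : IsOpen Ω) (hb : Bornology.IsBounded Ω)
    (hv : 0 < volume Ω) (hρ : Continuous ρ) (hρ0 : ∀ x, 0 ≤ ρ x) (hs : Function.support ρ ⊆ Ω)
    (hm : ∫ x, ρ x = M) :
    (M / (volume Ω).toReal) ^ γ * (volume Ω).toReal ≤ ∫ x, ρ x ^ γ := by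
  have hfin : volume Ω ≠ ⊤ := hb.measure_lt_top.ne
  have hV : 0 < (volume Ω).toReal := ENNReal.toReal_pos hv.ne' hfin
  set V := (volume Ω).toReal with hVdef
  have hz : ∀ x, x ∉ Ω → ρ x = 0 := fun x hx => by
    by_contra h; exact hx (hs h)
  set m := M / V with hmdef
  have hm0 : 0 < m := by positivity
  have hcpt : IsCompact (closure Ω) := hb.isCompact_closure
  have hcs : HasCompactSupport ρ := HasCompactSupport.intro hcpt
    fun x hx => hz x (fun h => hx (subset_closure h))
  have hi : Integrable ρ := hρ.integrable_of_hasCompactSupport hcs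
  have hγc : Continuous fun x => ρ x ^ γ := hρ.rpow_const (fun x => Or.inr (by linarith))
  have hi2 : Integrable (fun x => ρ x ^ γ) := hγc.integrable_of_hasCompactSupport
    (HasCompactSupport.intro hcpt fun x hx => by
      rw [hz x (fun h => hx (subset_closure h)), Real.zero_rpow (by linarith)])
  rw [← setIntegral_eq_integral_of_forall_compl_eq_zero (s := Ω) (fun x hx => hz x hx)] at hm
  rw [← setIntegral_eq_integral_of_forall_compl_eq_zero (s := Ω) (f := fun x => ρ x ^ γ)
    (fun x hx => by rw [hz x hx, Real.zero_rpow (by linarith)])]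
  have hpt : ∀ x, m ^ γ * (1 - γ) + (m ^ γ * γ / m) * ρ x ≤ ρ x ^ γ := by
    intro x
    have h1 : (-1:ℝ) ≤ ρ x / m - 1 := by
      have : 0 ≤ ρ x / m := div_nonneg (hρ0 x) hm0.le
      linarith
    have h2 := one_add_mul_self_le_rpow_one_add h1 hγ.le
    rw [add_sub_cancel, Real.div_rpow (hρ0 x) hm0.le] at h2
    have hmg : 0 < m ^ γ := Real.rpow_pos_of_pos hm0 γ
    rw [le_div_iff₀ hmg] at h2
    calc _ = (1 + γ * (ρ x / m - 1)) * m ^ γ := by field_simp; ring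
      _ ≤ _ := h2
  have hic : IntegrableOn (fun _ : EuclideanSpace ℝ (Fin N) => m ^ γ * (1 - γ)) Ω :=
    integrableOn_const hfin
  have hir : IntegrableOn (fun x => (m ^ γ * γ / m) * ρ x) Ω := (hi.const_mul _).integrableOn
  have hmon := integral_mono (μ := volume.restrict Ω) (hic.add hir) hi2.integrableOn
    (fun x => hpt x)
  simp only [Pi.add_apply] at hmon
  rw [integral_add hic hir, setIntegral_const, integral_const_mul, hm] at hmon
  refine le_trans (le_of_eq ?_) hmon
  simp only [smul_eq_mul, measureReal_def]
  rw [← hVdef]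
  have : M = m * V := by rw [hmdef]; field_simp
  rw [this]
  field_simp
  ring

lemma div_aux (w : EuclideanSpace ℝ (Fin N) → ℝ) (hw : ContDiff ℝ 1 w)
    (V : Fin N → EuclideanSpace ℝ (Fin N) → ℝ) (hV : ∀ j, ContDiff ℝ 1 (V j))
    (hc : ∀ j, HasCompactSupport (V j)) :
    Integrable (fun x => w x * ∑ j, fderiv ℝ (V j) x (EuclideanSpace.single j 1)) ∧
    ∫ x, w x * ∑ j, fderiv ℝ (V j) x (EuclideanSpace.single j 1)
      = - ∑ j, ∫ x, fderiv ℝ w x (EuclideanSpace.single j 1) * V j x := by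
  have hi : ∀ j, Integrable (fun x => w x * fderiv ℝ (V j) x (EuclideanSpace.single j 1)) := by
    intro j
    have h1 := (hV j).continuous_fderiv one_ne_zero
    have h2 := hw.continuous
    exact Continuous.integrable_of_hasCompactSupport (by fun_prop)
      (HasCompactSupport.mul_left ((hc j).fderiv_apply ℝ _))
  simp_rw [Finset.mul_sum]
  refine ⟨integrable_finsetSum _ fun j _ => hi j, ?_⟩
  rw [integral_finsetSum _ fun j _ => hi j, ← Finset.sum_neg_distrib]
  exact Finset.sum_congr rfl fun j _ => ibp_aux w (V j) hw (hV j) (hc j) _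

lemma coord_contDiff (i : Fin N) : ContDiff ℝ 1 (fun x : EuclideanSpace ℝ (Fin N) => x i) := by
  fun_prop

lemma coord_fderiv (i : Fin N) (x v : EuclideanSpace ℝ (Fin N)) :
    fderiv ℝ (fun x : EuclideanSpace ℝ (Fin N) => x i) x v = v i := by
  have : HasFDerivAt (fun x : EuclideanSpace ℝ (Fin N) => x i) (EuclideanSpace.proj (𝕜 := ℝ) i) x :=
    (EuclideanSpace.proj (𝕜 := ℝ) i).hasFDerivAt
  rw [this.fderiv]
  simp

end helpers3



/-- **Stability for `N ≥ 2`, `γ > 1`, `K > 0`, no damping.** For a global classical solution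
with compact support of the `N`-dimensional Euler–Poisson equations with repulsive forces
and `β = 0`, with positive total mass `M` and supports in a fixed bounded set `Ω` of positive
finite volume, one has `liminf_{t→∞} R(t)/t ≥ (N K M^{γ-1}/|Ω|^{γ-1})^{1/2}`, where
`R(t) = max{|x| : x ∈ supp ρ(t,·)}`. -/
theorem stability_euler_poisson_repulsive_pressure
    (N : ℕ) (hN : 2 ≤ N) (γ K : ℝ) (hγ : 1 < γ) (hK : 0 < K)
    (ρ : ℝ → EuclideanSpace ℝ (Fin N) → ℝ)
    (u : ℝ → EuclideanSpace ℝ (Fin N) → EuclideanSpace ℝ (Fin N))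
    (Φ : ℝ → EuclideanSpace ℝ (Fin N) → ℝ)
    (M : ℝ) (hM : 0 < M)
    (hρreg : ContDiffOn ℝ 1 (fun p : ℝ × EuclideanSpace ℝ (Fin N) => ρ p.1 p.2)
      (Set.Ici (0:ℝ) ×ˢ Set.univ))
    (hureg : ContDiffOn ℝ 1 (fun p : ℝ × EuclideanSpace ℝ (Fin N) => u p.1 p.2)
      (Set.Ici (0:ℝ) ×ˢ Set.univ))
    (hρnonneg : ∀ t x, 0 ≤ ρ t x)
    (Ω : Set (EuclideanSpace ℝ (Fin N)))
    (hΩopen : IsOpen Ω) (hΩbdd : Bornology.IsBounded Ω)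
    (hΩvol : 0 < volume Ω)
    (hsupp : ∀ t, 0 ≤ t →
      Function.support (ρ t) ⊆ Ω ∧ Function.support (u t) ⊆ Ω)
    -- the potential `Φ` is given by convolution with the Green function
    (hΦ : ∀ t x, Φ t x =
      ∫ y, (if N = 2 then Real.log ‖x - y‖ else -‖x - y‖ ^ (-((N:ℝ) - 2))) * ρ t y)
    -- `M` is the (conserved) total mass
    (hmass_const : ∀ t, 0 ≤ t → (∫ x, ρ t x) = M)
    -- mass equation: `ρ_t + div(ρ u) = 0`
    (hmass : ∀ t, 0 ≤ t → ∀ x,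
      deriv (fun s => ρ s x) t
        + ∑ i, fderiv ℝ (fun y => ρ t y * u t y i) x (EuclideanSpace.single i 1) = 0)
    -- momentum equation with `β = 0`: `(ρ u)_t + div(ρ u ⊗ u) + ∇P = ρ ∇Φ`, `P = K ρ^γ`
    (hmom : ∀ t, 0 ≤ t → ∀ x, ∀ i : Fin N,
      deriv (fun s => ρ s x * u s x i) t
        + ∑ j, fderiv ℝ (fun y => ρ t y * u t y i * u t y j) x (EuclideanSpace.single j 1)
        + fderiv ℝ (fun y => K * ρ t y ^ γ) x (EuclideanSpace.single i 1)
      = ρ t x * fderiv ℝ (Φ t) x (EuclideanSpace.single i 1)) :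
    Real.sqrt ((N : ℝ) * K * M ^ (γ - 1) / (volume Ω).toReal ^ (γ - 1)) ≤
      Filter.liminf
        (fun t => sSup ((fun x => ‖x‖) '' Function.support (ρ t)) / t)
        Filter.atTop := by
  exfalso
  -- basic facts
  have hSc : IsCompact (closure Ω) := hΩbdd.isCompact_closure
  have hzρ : ∀ t, 0 < t → ∀ x, x ∉ closure Ω → ρ t x = 0 := fun t ht x hx => by
    by_contra h
    exact hx (subset_closure ((hsupp t ht.le).1 h))
  have hcsρ : ∀ t, 0 < t → HasCompactSupport (ρ t) := fun t ht =>
    HasCompactSupport.intro hSc (hzρ t ht)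
  have hsub : Set.Ioi (0:ℝ) ×ˢ (Set.univ : Set (EuclideanSpace ℝ (Fin N)))
      ⊆ Set.Ici (0:ℝ) ×ˢ Set.univ := Set.prod_mono_left Set.Ioi_subset_Ici_self
  have hρr := hρreg.mono hsub
  have hur := hureg.mono hsub
  have hui : ∀ i, ContDiffOn ℝ 1 (fun p : ℝ × EuclideanSpace ℝ (Fin N) => u p.1 p.2 i)
      (Set.Ioi (0:ℝ) ×ˢ Set.univ) := fun i => (coord_contDiff i).comp_contDiffOn hur
  have slice : ∀ f : ℝ → EuclideanSpace ℝ (Fin N) → ℝ,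
      ContDiffOn ℝ 1 (fun p : ℝ × EuclideanSpace ℝ (Fin N) => f p.1 p.2)
        (Set.Ioi (0:ℝ) ×ˢ Set.univ) → ∀ t, 0 < t → ContDiff ℝ 1 (f t) := by
    intro f hf t ht
    exact hf.comp_contDiff (f := fun x => (t, x)) (by fun_prop)
      fun x => Set.mk_mem_prod (Set.mem_Ioi.2 ht) (Set.mem_univ x)
  have hρt := slice ρ hρr
  have hut : ∀ i, ∀ t, 0 < t → ContDiff ℝ 1 (fun x => u t x i) := fun i =>
    slice (fun t x => u t x i) (hui i)
  -- the functionals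
  set H : ℝ → ℝ := fun t => ∫ x, ρ t x * ‖x‖ ^ 2 with hH
  set Ji : Fin N → ℝ → ℝ := fun i t => ∫ x, x i * (ρ t x * u t x i) with hJi
  set J : ℝ → ℝ := fun t => ∑ i, Ji i t with hJ
  have hnsq : ContDiff ℝ 1 (fun x : EuclideanSpace ℝ (Fin N) => ‖x‖ ^ 2) := contDiff_norm_sq ℝ
  -- derivative of H
  have hHd : ∀ t, 0 < t → HasDerivAt H (2 * J t) t := by
    intro t ht
    have h1 := time_deriv_aux (fun t x => ρ t x * ‖x‖ ^ 2)
      (hρr.mul (hnsq.comp contDiff_snd).contDiffOn) (closure Ω) hSc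
      (fun t ht x hx => by simp only [hzρ t ht x hx, zero_mul]) t ht
    have h2 : ∀ x, deriv (fun s => ρ s x * ‖x‖ ^ 2) t = -(‖x‖ ^ 2 *
        ∑ i, fderiv ℝ (fun y => ρ t y * u t y i) x (EuclideanSpace.single i 1)) := by
      intro x
      rw [deriv_mul_const_field]
      have := hmass t ht.le x
      rw [eq_neg_of_add_eq_zero_left this]
      ring
    have h3 := div_aux (fun x => ‖x‖ ^ 2) hnsq (fun i y => ρ t y * u t y i)
      (fun i => (hρt t ht).mul (hut i t ht)) (fun i => (hcsρ t ht).mul_right)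
    simp_rw [h2] at h1
    rw [integral_neg, h3.2, neg_neg] at h1
    convert h1 using 1
    simp only [hJ, hJi]
    rw [Finset.mul_sum]
    refine Finset.sum_congr rfl fun i _ => ?_
    rw [← integral_const_mul]
    congr 1
    ext x
    rw [(hasStrictFDerivAt_norm_sq x).hasFDerivAt.fderiv]
    simp [EuclideanSpace.inner_single_right]
    ring
  -- derivative of the components of J
  have hJid : ∀ i, ∀ t, 0 < t → HasDerivAt (Ji i)
      ((∫ x, x i * (ρ t x * fderiv ℝ (Φ t) x (EuclideanSpace.single i 1)))
        + (∫ x, ρ t x * u t x i * u t x i) + ∫ x, K * ρ t x ^ γ) t := by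
    intro i t ht
    have h1 := time_deriv_aux (fun t x => x i * (ρ t x * u t x i))
      (((coord_contDiff i).comp contDiff_snd).contDiffOn.mul (hρr.mul (hui i))) (closure Ω) hSc
      (fun t ht x hx => by simp only [hzρ t ht x hx, zero_mul, mul_zero]) t ht
    have h2 : ∀ x : EuclideanSpace ℝ (Fin N), deriv (fun s => x i * (ρ s x * u s x i)) t =
        x i * (ρ t x * fderiv ℝ (Φ t) x (EuclideanSpace.single i 1))
        - x i * (∑ j, fderiv ℝ (fun y => ρ t y * u t y i * u t y j) x (EuclideanSpace.single j 1))
        - x i * fderiv ℝ (fun y => K * ρ t y ^ γ) x (EuclideanSpace.single i 1) := by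
      intro x
      rw [deriv_const_mul_field, ← hmom t ht.le x i]
      ring
    have hP : ContDiff ℝ 1 (fun y => K * ρ t y ^ γ) :=
      contDiff_const.mul ((hρt t ht).rpow_const_of_le (m := 1) (by push_cast; exact hγ.le))
    have hPc : HasCompactSupport (fun y => K * ρ t y ^ γ) :=
      HasCompactSupport.intro hSc fun x hx => by
        rw [hzρ t ht x hx, Real.zero_rpow (by linarith), mul_zero]
    have h3 := div_aux (fun x => x i) (coord_contDiff i) (fun j y => ρ t y * u t y i * u t y j)
      (fun j => ((hρt t ht).mul (hut i t ht)).mul (hut j t ht))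
      (fun j => (hcsρ t ht).mul_right.mul_right)
    have h4 := ibp_aux (fun x => x i) (fun y => K * ρ t y ^ γ) (coord_contDiff i) hP hPc
      (EuclideanSpace.single i 1)
    have hΦ1 := (repulsion_aux hN (ρ t) (hρt t ht) (hcsρ t ht) (hρnonneg t) (Φ t) (hΦ t)).1
    have i1 : Integrable (fun x : EuclideanSpace ℝ (Fin N) =>
        x i * (ρ t x * fderiv ℝ (Φ t) x (EuclideanSpace.single i 1))) := by
      have c1 := hΦ1.continuous_fderiv one_ne_zero
      have c2 := (hρt t ht).continuous
      exact Continuous.integrable_of_hasCompactSupport (by fun_prop)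
        ((hcsρ t ht).mul_right.mul_left)
    have i3 : Integrable (fun x : EuclideanSpace ℝ (Fin N) =>
        x i * fderiv ℝ (fun y => K * ρ t y ^ γ) x (EuclideanSpace.single i 1)) := by
      have c1 := hP.continuous_fderiv one_ne_zero
      exact Continuous.integrable_of_hasCompactSupport (by fun_prop)
        (HasCompactSupport.mul_left (hPc.fderiv_apply ℝ _))
    simp_rw [h2] at h1
    have i13 := i1.sub h3.1
    simp only [Pi.sub_def] at i13
    rw [integral_sub i13 i3, integral_sub i1 h3.1, h3.2, h4] at h1
    convert h1 using 1
    simp only [coord_fderiv]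
    rw [Finset.sum_eq_single i]
    · simp
    · intro j _ hj
      simp [Ne.symm hj]
    · simp
  have hJd : ∀ t, 0 < t → HasDerivAt J (∑ i, ((∫ x, x i * (ρ t x * fderiv ℝ (Φ t) x
      (EuclideanSpace.single i 1))) + (∫ x, ρ t x * u t x i * u t x i)
      + ∫ x, K * ρ t x ^ γ)) t := fun t ht =>
    HasDerivAt.fun_sum fun i _ => hJid i t ht
  have hV : 0 < (volume Ω).toReal := ENNReal.toReal_pos hΩvol.ne' hΩbdd.measure_lt_top.ne
  have hN0 : (0:ℝ) < N := by exact_mod_cast (by omega : 0 < N)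
  obtain ⟨R, hR⟩ := hSc.isBounded.subset_closedBall 0
  refine ode_aux H J _ (N * (K * ((M / (volume Ω).toReal) ^ γ * (volume Ω).toReal))) (M * R ^ 2)
    (by positivity) hHd hJd ?_ ?_
  · intro t ht
    obtain ⟨hΦ1, hΦ2⟩ := repulsion_aux hN (ρ t) (hρt t ht) (hcsρ t ht) (hρnonneg t) (Φ t) (hΦ t)
    have hj := jensen_aux (ρ t) γ M hγ hM Ω hΩopen hΩbdd hΩvol (hρt t ht).continuous (hρnonneg t)
      (hsupp t ht.le).1 (hmass_const t ht.le)
    rw [Finset.sum_add_distrib, Finset.sum_add_distrib]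
    have s1 : 0 ≤ ∑ i, ∫ x : EuclideanSpace ℝ (Fin N),
        x i * (ρ t x * fderiv ℝ (Φ t) x (EuclideanSpace.single i 1)) := by
      rw [← integral_finsetSum]
      · refine hΦ2.trans_eq ?_
        congr 1
        ext x
        have hx : x = ∑ i, x i • EuclideanSpace.single i (1:ℝ) := by
          ext j
          simp [Finset.sum_apply, Pi.single_apply]
        conv_lhs => enter [2, 2]; rw [hx]
        rw [map_sum, Finset.mul_sum]
        refine Finset.sum_congr rfl fun i _ => ?_
        rw [map_smul, smul_eq_mul]
        ring
      · intro i _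
        have c1 := hΦ1.continuous_fderiv one_ne_zero
        have c2 := (hρt t ht).continuous
        exact Continuous.integrable_of_hasCompactSupport (by fun_prop)
          ((hcsρ t ht).mul_right.mul_left)
    have s2 : 0 ≤ ∑ i, ∫ x : EuclideanSpace ℝ (Fin N), ρ t x * u t x i * u t x i := by
      refine Finset.sum_nonneg fun i _ => integral_nonneg fun x => ?_
      simp only [Pi.zero_apply]
      rw [mul_assoc]
      exact mul_nonneg (hρnonneg t x) (mul_self_nonneg _)
    have s3 : (N:ℝ) * (K * ((M / (volume Ω).toReal) ^ γ * (volume Ω).toReal))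
        ≤ ∑ _i : Fin N, ∫ x : EuclideanSpace ℝ (Fin N), K * ρ t x ^ γ := by
      rw [Finset.sum_const, Finset.card_univ, Fintype.card_fin, nsmul_eq_mul, integral_const_mul]
      gcongr
    linarith
  · intro t ht
    have c2 := (hρt t ht).continuous
    simp only [hH]
    rw [← hmass_const t ht.le, ← integral_mul_const]
    refine integral_mono ?_ ?_ ?_
    · exact Continuous.integrable_of_hasCompactSupport (by fun_prop) (hcsρ t ht).mul_right
    · exact Continuous.integrable_of_hasCompactSupport (by fun_prop) (hcsρ t ht).mul_right
    · intro x
      by_cases hx : x ∈ closure Ω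
      · have h1 := hR hx
        rw [Metric.mem_closedBall, dist_zero_right] at h1
        have := hρnonneg t x
        simp only
        gcongr
      · simp [hzρ t ht x hx]
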